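/- Let s : [0,1] → ℝ be as follows: s(r) = −∫_0^r log sin(πt/4) dt + C r with C = ∫_0^1 log sin(πt/4) dt, and let S(p) = Σ_j s(p_j) on P. Define f̲(r) = r² inf_{t∈(0,1]} s''(rt)/s''(t) and f̄(r) = r² sup_{t∈(0,1]} s''(rt)/s''(t). For x ∈ (0,1), let P(x) ∈ P_{22} be the matrix with entries p^1_1 = 1/2, p^2_1 = 0, p^1_2 = x/2, p^2_2 = (1−x)/2 (so the column sums are p_1 = p_2 = 1/2). Then Σ_{j=1}^2 f̲(p_j) S((p^1_j/p_j, p^2_j/p_j)) + s'(1) Σ_{j=1}^2 (f̄(p_j) − f̲(p_j)) = (1/2)(s(x) + s(1−x)) + (s'(1)/2)(√2 − 1), which converges to (s'(1)/2)(√2 − 1) < 0 as x ↓ 0. In particular, for all sufficiently small x ∈ (0,1), the lower bound in the two-sided extensivity estimate is strictly negative, i.e. Σ_{j=1}^2 f̲(p_j) S((p^1_j/p_j, p^2_j/p_j)) + s'(1) Σ_{j=1}^2 (f̄(p_j) − f̲(p_j)) < 0. -/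

import Mathlib

open Real Set Filter

/-- `C = ∫_0^1 log sin(πt/4) dt`. -/
noncomputable def logSinConst : ℝ := ∫ t in (0:ℝ)..1, Real.log (Real.sin (Real.pi / 4 * t))

/-- `s(r) = −∫_0^r log sin(πt/4) dt + C r`. -/
noncomputable def cotDensity (r : ℝ) : ℝ :=
  -(∫ t in (0:ℝ)..r, Real.log (Real.sin (Real.pi / 4 * t))) + logSinConst * r

/-- `f̲(r) = r² · inf_{t ∈ (0,1]} s''(rt)/s''(t)`. -/
noncomputable def flo (s'' : ℝ → ℝ) (r : ℝ) : ℝ :=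
  r ^ 2 * ⨅ t : Set.Ioc (0:ℝ) 1, s'' (r * (t : ℝ)) / s'' (t : ℝ)

/-- `f̄(r) = r² · sup_{t ∈ (0,1]} s''(rt)/s''(t)`. -/
noncomputable def fup (s'' : ℝ → ℝ) (r : ℝ) : ℝ :=
  r ^ 2 * ⨆ t : Set.Ioc (0:ℝ) 1, s'' (r * (t : ℝ)) / s'' (t : ℝ)

theorem quarter_pi_mul_mem_Ioo {t : ℝ} (ht : t ∈ Ioo (0:ℝ) 2) :
    Real.pi / 4 * t ∈ Ioo (0:ℝ) (Real.pi / 2) :=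
  ⟨mul_pos (by positivity) ht.1, by nlinarith [ht.2, Real.pi_pos]⟩

theorem sin_quarter_pi_mul_pos {t : ℝ} (ht : t ∈ Ioo (0:ℝ) 2) :
    0 < Real.sin (Real.pi / 4 * t) :=
  Real.sin_pos_of_pos_of_lt_pi (quarter_pi_mul_mem_Ioo ht).1
    (by linarith [(quarter_pi_mul_mem_Ioo ht).2, Real.pi_pos])

theorem cos_quarter_pi_mul_pos {t : ℝ} (ht : t ∈ Ioo (0:ℝ) 2) :
    0 < Real.cos (Real.pi / 4 * t) :=
  Real.cos_pos_of_mem_Ioo ⟨by linarith [(quarter_pi_mul_mem_Ioo ht).1, Real.pi_pos],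
    (quarter_pi_mul_mem_Ioo ht).2⟩

theorem intervalIntegrable_log_sin_quarter_pi_mul (a b : ℝ) :
    IntervalIntegrable (fun t => Real.log (Real.sin (Real.pi / 4 * t)))
      MeasureTheory.volume a b := by
  have h : IntervalIntegrable (fun t => Real.log (Real.sin t)) MeasureTheory.volume
      (Real.pi / 4 * a) (Real.pi / 4 * b) := intervalIntegrable_log_sin
  have h2 := h.comp_mul_left (c := Real.pi / 4)
  simpa [mul_div_cancel_left₀, Real.pi_ne_zero] using h2

theorem continuous_cotDensity : Continuous cotDensity := by
  unfold cotDensity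
  exact (intervalIntegral.continuous_primitive intervalIntegrable_log_sin_quarter_pi_mul 0).neg.add
    (continuous_const.mul continuous_id)

theorem cotDensity_zero : cotDensity 0 = 0 := by simp [cotDensity]

theorem cotDensity_one : cotDensity 1 = 0 := by simp [cotDensity, logSinConst]

theorem hasDerivAt_log_sin_quarter_pi_mul {t : ℝ} (ht : t ∈ Ioo (0:ℝ) 2) :
    HasDerivAt (fun t => Real.log (Real.sin (Real.pi / 4 * t)))
      (Real.pi / 4 * Real.cos (Real.pi / 4 * t) / Real.sin (Real.pi / 4 * t)) t := by
  have h := (((hasDerivAt_id' t).const_mul (Real.pi / 4)).sin).log (sin_quarter_pi_mul_pos ht).ne'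
  convert h using 1
  ring

theorem deriv_cotDensity {t : ℝ} (ht : t ∈ Ioo (0:ℝ) 2) :
    deriv cotDensity t = -Real.log (Real.sin (Real.pi / 4 * t)) + logSinConst := by
  have hc := (hasDerivAt_log_sin_quarter_pi_mul ht).continuousAt
  have h := intervalIntegral.integral_hasDerivAt_right
    (intervalIntegrable_log_sin_quarter_pi_mul 0 t)
    (Measurable.stronglyMeasurable (by fun_prop)).stronglyMeasurableAtFilter hc
  have h2 := h.neg.add ((hasDerivAt_id t).const_mul logSinConst)
  rw [mul_one] at h2
  exact h2.deriv

theorem deriv_deriv_cotDensity {t : ℝ} (ht : t ∈ Ioo (0:ℝ) 2) :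
    deriv (deriv cotDensity) t =
      -(Real.pi / 4 * Real.cos (Real.pi / 4 * t) / Real.sin (Real.pi / 4 * t)) := by
  have h : deriv cotDensity =ᶠ[nhds t]
      fun t => -Real.log (Real.sin (Real.pi / 4 * t)) + logSinConst := by
    filter_upwards [isOpen_Ioo.mem_nhds ht] with u hu using deriv_cotDensity hu
  rw [h.deriv_eq]
  exact ((hasDerivAt_log_sin_quarter_pi_mul ht).neg.add_const logSinConst).deriv

theorem deriv_deriv_cotDensity_half_div {t : ℝ} (ht : t ∈ Ioo (0:ℝ) 2) :
    deriv (deriv cotDensity) (1 / 2 * t) / deriv (deriv cotDensity) t =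
      1 + (Real.cos (Real.pi / 4 * t))⁻¹ := by
  have ht' : 1 / 2 * t ∈ Ioo (0:ℝ) 2 := ⟨by linarith [ht.1], by linarith [ht.1, ht.2]⟩
  rw [deriv_deriv_cotDensity ht, deriv_deriv_cotDensity ht']
  have h1 := (sin_quarter_pi_mul_pos ht').ne'
  have h2 := (cos_quarter_pi_mul_pos ht').ne'
  have h3 := (cos_quarter_pi_mul_pos ht).ne'
  have e : Real.pi / 4 * t = 2 * (Real.pi / 4 * (1 / 2 * t)) := by ring
  rw [e] at h3 ⊢
  generalize Real.pi / 4 * (1 / 2 * t) = u at *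
  rw [Real.sin_two_mul]
  have h4 := Real.cos_two_mul u
  have hpi := Real.pi_ne_zero
  field_simp
  linarith

theorem one_le_inv_cos_quarter_pi_mul_and_le_sqrt_two {t : ℝ} (ht : t ∈ Ioc (0:ℝ) 1) :
    1 ≤ (Real.cos (Real.pi / 4 * t))⁻¹ ∧ (Real.cos (Real.pi / 4 * t))⁻¹ ≤ √2 := by
  have hp := cos_quarter_pi_mul_pos (t := t) ⟨ht.1, by linarith [ht.2]⟩
  refine ⟨(one_le_inv₀ hp).2 (Real.cos_le_one _), ?_⟩
  have h : Real.cos (Real.pi / 4) ≤ Real.cos (Real.pi / 4 * t) :=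
    Real.cos_le_cos_of_nonneg_of_le_pi (mul_nonneg (by positivity) ht.1.le)
      (by linarith [Real.pi_pos]) (by nlinarith [ht.2, Real.pi_pos])
  rw [Real.cos_pi_div_four] at h
  rw [inv_le_iff_one_le_mul₀ hp]
  nlinarith [Real.mul_self_sqrt (show (0:ℝ) ≤ 2 by norm_num), Real.sqrt_nonneg 2]

theorem flo_half : flo (deriv (deriv cotDensity)) (1 / 2) = 1 / 2 := by
  have : (⨅ t : Set.Ioc (0:ℝ) 1, deriv (deriv cotDensity) (1 / 2 * (t : ℝ)) /
      deriv (deriv cotDensity) (t : ℝ)) = 2 := by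
    have : Nonempty (Set.Ioc (0:ℝ) 1) := ⟨⟨1, by simp⟩⟩
    apply ciInf_eq_of_forall_ge_of_forall_gt_exists_lt
    · rintro ⟨t, ht⟩
      rw [deriv_deriv_cotDensity_half_div ⟨ht.1, by linarith [ht.2]⟩]
      linarith [(one_le_inv_cos_quarter_pi_mul_and_le_sqrt_two ht).1]
    · intro w hw
      have hc : ContinuousAt (fun t : ℝ => 1 + (Real.cos (Real.pi / 4 * t))⁻¹) 0 :=
        continuousAt_const.add (ContinuousAt.inv₀ (by fun_prop) (by simp))
      have hlt := hc.eventually_lt_const (u := w) (by norm_num; linarith)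
      obtain ⟨t, h, ht⟩ := ((hlt.filter_mono nhdsWithin_le_nhds).and
        (Ioc_mem_nhdsGT (zero_lt_one (α := ℝ)))).exists
      refine ⟨⟨t, ht⟩, ?_⟩
      rwa [deriv_deriv_cotDensity_half_div ⟨ht.1, by linarith [ht.2]⟩]
  rw [flo, this]
  norm_num

theorem fup_half : fup (deriv (deriv cotDensity)) (1 / 2) = 1 / 4 * (1 + √2) := by
  have : (⨆ t : Set.Ioc (0:ℝ) 1, deriv (deriv cotDensity) (1 / 2 * (t : ℝ)) /
      deriv (deriv cotDensity) (t : ℝ)) = 1 + √2 := by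
    have : Nonempty (Set.Ioc (0:ℝ) 1) := ⟨⟨1, by simp⟩⟩
    apply ciSup_eq_of_forall_le_of_forall_lt_exists_gt
    · rintro ⟨t, ht⟩
      rw [deriv_deriv_cotDensity_half_div ⟨ht.1, by linarith [ht.2]⟩]
      linarith [(one_le_inv_cos_quarter_pi_mul_and_le_sqrt_two ht).2]
    · intro w hw
      refine ⟨⟨1, by simp⟩, ?_⟩
      rw [deriv_deriv_cotDensity_half_div (by norm_num), mul_one, Real.cos_pi_div_four, inv_div,
        Real.div_sqrt]
      exact hw
  rw [fup, this]
  norm_num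

theorem deriv_cotDensity_one_neg : deriv cotDensity 1 < 0 := by
  rw [deriv_cotDensity (by norm_num), mul_one]
  have hi := intervalIntegrable_log_sin_quarter_pi_mul 0 1
  have h := intervalIntegral.intervalIntegral_pos_of_pos_on
    ((intervalIntegrable_const (c := Real.log (Real.sin (Real.pi / 4)))).sub hi)
    (fun t ht => sub_pos.2 (Real.log_lt_log
      (sin_quarter_pi_mul_pos ⟨ht.1, by linarith [ht.2]⟩)
      (Real.sin_lt_sin_of_lt_of_le_pi_div_two
        (by linarith [mul_pos (show 0 < Real.pi / 4 by positivity) ht.1, Real.pi_pos])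
        (by linarith [Real.pi_pos]) (by nlinarith [ht.2, Real.pi_pos])))) zero_lt_one
  rw [intervalIntegral.integral_sub intervalIntegrable_const hi] at h
  simp only [intervalIntegral.integral_const, sub_zero, one_smul] at h
  rw [logSinConst]
  linarith

/-- For the matrix `P(x) ∈ P_{22}` with entries `p¹₁ = 1/2`, `p²₁ = 0`, `p¹₂ = x/2`,
`p²₂ = (1−x)/2` (column sums `p₁ = p₂ = 1/2`), the lower bound of the two-sided
extensivity estimate for `cotDensity` equals
`(1/2)(s(x) + s(1−x)) + (s'(1)/2)(√2 − 1)`, converges to `(s'(1)/2)(√2 − 1) < 0` as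
`x ↓ 0`, and hence is strictly negative for all sufficiently small `x ∈ (0,1)`. -/
theorem stmt_14 :
    let s'' : ℝ → ℝ := deriv (deriv cotDensity)
    let lhs : ℝ → ℝ := fun x =>
      (flo s'' (1 / 2) * (cotDensity 1 + cotDensity 0) +
        flo s'' (1 / 2) * (cotDensity x + cotDensity (1 - x))) +
      deriv cotDensity 1 *
        ((fup s'' (1 / 2) - flo s'' (1 / 2)) + (fup s'' (1 / 2) - flo s'' (1 / 2)))
    (∀ x ∈ Ioo (0:ℝ) 1,
      lhs x = (1 / 2) * (cotDensity x + cotDensity (1 - x)) +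
        (deriv cotDensity 1 / 2) * (Real.sqrt 2 - 1)) ∧
    Tendsto lhs (nhdsWithin 0 (Ioi 0))
      (nhds ((deriv cotDensity 1 / 2) * (Real.sqrt 2 - 1))) ∧
    (deriv cotDensity 1 / 2) * (Real.sqrt 2 - 1) < 0 ∧
    ∃ ε > (0:ℝ), ∀ x ∈ Ioo (0:ℝ) ε, lhs x < 0 := by
  intro s'' lhs
  have hlhs : ∀ x, lhs x = (1 / 2) * (cotDensity x + cotDensity (1 - x)) +
      (deriv cotDensity 1 / 2) * (√2 - 1) := by
    intro x
    simp only [lhs, s'', flo_half, fup_half, cotDensity_zero, cotDensity_one]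
    ring
  have hlim : Tendsto lhs (nhdsWithin 0 (Ioi 0))
      (nhds ((deriv cotDensity 1 / 2) * (√2 - 1))) := by
    have hc : Continuous lhs := by
      rw [funext hlhs]
      have := continuous_cotDensity
      fun_prop
    have h := hc.tendsto 0
    rw [hlhs 0, sub_zero, cotDensity_zero, cotDensity_one, add_zero, mul_zero, zero_add] at h
    exact h.mono_left nhdsWithin_le_nhds
  have hneg : (deriv cotDensity 1 / 2) * (√2 - 1) < 0 :=
    mul_neg_of_neg_of_pos (by linarith [deriv_cotDensity_one_neg])
      (sub_pos.2 Real.one_lt_sqrt_two)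
  refine ⟨fun x _ => hlhs x, hlim, hneg, ?_⟩
  obtain ⟨ε, hε, h⟩ := mem_nhdsGT_iff_exists_Ioo_subset.1 (hlim.eventually_lt_const hneg)
  exact ⟨ε, hε, fun x hx => h hx⟩
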